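/- arXiv:1605.08669 — 2 statements merged into one kernel-verified Lean document; each statement's English description precedes it below -/
import Mathlib

section
/- Assume no three of the control points are collinear (λi ≠ 0 for i = 0,1,2,3), all weights are nonzero (wi ≠ 0 for all i), and φ1 ≠ 0 and φ2 ≠ 0. Then: (a) S̃1(c0) = 0 and S̃2(c3) = 0 (the lines S̃1 = 0 and S̃2 = 0 pass through the endpoints c0 and c3 respectively); and (b) for every point (x,y) ∈ ℝ² with S̃1(x,y) = 0 and S̃2(x,y) = 0, one has q(x,y) = 0 and ∇q(x,y) = (0,0), i.e., any common zero of S̃1 and S̃2 is a singular point of the implicit curve q = 0. -/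
noncomputable section

/-- Determinant of the matrix [[x, y, 1], [a₁, a₂, 1], [b₁, b₂, 1]]. -/
def det3 (x y a₁ a₂ b₁ b₂ : ℝ) : ℝ :=
  x * (a₂ - b₂) - y * (a₁ - b₁) + (a₁ * b₂ - a₂ * b₁)

/-- L_{ij}(x,y): the implicit linear form of the line through points `p` and `q`. -/
def lineL (p q : ℝ × ℝ) (x y : ℝ) : ℝ := det3 x y p.1 p.2 q.1 q.2

/-- λ_{ijk}: determinant of [[p₁,p₂,1],[q₁,q₂,1],[r₁,r₂,1]]. -/
def lam (p q r : ℝ × ℝ) : ℝ := det3 p.1 p.2 q.1 q.2 r.1 r.2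

/-- Gradient of a bivariate function. -/
def grad (f : ℝ → ℝ → ℝ) (x y : ℝ) : ℝ × ℝ :=
  (deriv (fun s => f s y) x, deriv (fun s => f x s) y)

/-- Derivative, along a direction in which the six lines have slopes `dA, …, dF`, of the implicit
equation: it vanishes at the common zero of the two singular lines.  Here `A, B, C, D, E, F` are
the values of `L₀₂, L₀₃, L₁₃, L₀₁, L₂₃, L₁₂`. -/
theorem implicit_derivative_eq_zero {u0 u1 u2 u3 l0 l1 l2 l3 : ℝ}
    (hu1 : u1 ≠ 0) (hu2 : u2 ≠ 0) (hl1 : l1 ≠ 0) (hl2 : l2 ≠ 0)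
    {p1 p2 p3 : ℝ}
    (hp1 : p1 = u0 * u2 * l1 ^ 2 - u1 ^ 2 * l0 * l2)
    (hp2 : p2 = u1 * u3 * l2 ^ 2 - u2 ^ 2 * l1 * l3)
    (hp3 : p3 = u1 * u2 * l0 * l3 - u0 * u3 * l1 * l2)
    (hp1ne : p1 ≠ 0) (hp2ne : p2 ≠ 0)
    {A B C D E F dA dB dC dD dE dF : ℝ}
    (hS1 : u2 * p1 * A - u1 * p3 * B = 0) (hS2 : u1 * p2 * C - u2 * p3 * B = 0)
    (hD : l1 * D = -l2 * A - l3 * B) (hE : l2 * E = -l1 * C - l0 * B)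
    (hF : l1 * l2 * F = -l0 * l2 * A - l0 * l3 * B - l1 * l3 * C)
    (hdD : l1 * dD = -l2 * dA - l3 * dB) (hdE : l2 * dE = -l1 * dC - l0 * dB)
    (hdF : l1 * l2 * dF = -l0 * l2 * dA - l0 * l3 * dB - l1 * l3 * dC) :
    -(l1 ^ 2 * l2 ^ 2 * (u0 * u1 * u2 * u3) - u1 ^ 2 * u2 ^ 2 * (l0 * l1 * l2 * l3)) *
        ((dD * F + D * dF) * E + D * F * dE) +
      (l1 ^ 3 * l3 * (u0 * u1 * u2 * u3) - u1 ^ 3 * u3 * (l0 * l1 * l2 * l3)) *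
        (dD * C ^ 2 + D * (2 * C * dC)) +
      (l0 * l2 ^ 3 * (u0 * u1 * u2 * u3) - u0 * u2 ^ 3 * (l0 * l1 * l2 * l3)) *
        (2 * A * dA * E + A ^ 2 * dE) +
      (l0 ^ 2 * l3 ^ 2 * (u0 * u1 * u2 * u3) - u0 ^ 2 * u3 ^ 2 * (l0 * l1 * l2 * l3)) *
        (3 * B ^ 2 * dB) = 0 := by
  obtain ⟨t, hB⟩ : ∃ t, B = u1 * u2 * p1 * p2 * t :=
    ⟨B / (u1 * u2 * p1 * p2), by field_simp⟩
  have hA : A = u1 ^ 2 * p2 * p3 * t := by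
    apply mul_left_cancel₀ (mul_ne_zero hu2 hp1ne)
    linear_combination hS1 + u1 * p3 * hB
  have hC : C = u2 ^ 2 * p1 * p3 * t := by
    apply mul_left_cancel₀ (mul_ne_zero hu1 hp2ne)
    linear_combination hS2 + u2 * p3 * hB
  have hD' : D = u0 * u1 * p2 ^ 2 * t := by
    apply mul_left_cancel₀ hl1
    rw [hD, hA, hB, hp1, hp2, hp3]
    ring
  have hE' : E = u2 * u3 * p1 ^ 2 * t := by
    apply mul_left_cancel₀ hl2
    rw [hE, hC, hB, hp1, hp2, hp3]
    ring
  have hF' : F = (u0 * u1 ^ 3 * u3 ^ 2 * l0 * l2 ^ 3 -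
      3 * u0 * u1 ^ 2 * u2 ^ 2 * u3 * l0 * l1 * l2 * l3 +
      u1 ^ 3 * u2 ^ 3 * l0 ^ 2 * l3 ^ 2 + u0 ^ 2 * u2 ^ 3 * u3 * l1 ^ 3 * l3) * t := by
    apply mul_left_cancel₀ (mul_ne_zero hl1 hl2)
    rw [hF, hA, hC, hB, hp1, hp2, hp3]
    ring
  have hdD' : dD = (-l2 * dA - l3 * dB) / l1 := by rw [← hdD]; field_simp
  have hdE' : dE = (-l1 * dC - l0 * dB) / l2 := by rw [← hdE]; field_simp
  have hdF' : dF = (-l0 * l2 * dA - l0 * l3 * dB - l1 * l3 * dC) / (l1 * l2) := by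
    rw [← hdF]; field_simp
  rw [hdD', hdE', hdF', hA, hB, hC, hD', hE', hF', hp1, hp2, hp3]
  field_simp
  ring

theorem hasDerivAt_lineL_fst (p q : ℝ × ℝ) (x y : ℝ) :
    HasDerivAt (fun s => lineL p q s y) (p.2 - q.2) x := by
  have h := (((hasDerivAt_id x).mul_const (p.2 - q.2)).sub_const (y * (p.1 - q.1))).add_const
    (p.1 * q.2 - p.2 * q.1)
  rw [one_mul] at h
  exact h

theorem hasDerivAt_lineL_snd (p q : ℝ × ℝ) (x y : ℝ) :
    HasDerivAt (fun s => lineL p q x s) (-(p.1 - q.1)) y := by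
  have h := (((hasDerivAt_id y).mul_const (p.1 - q.1)).const_sub (x * (p.2 - q.2))).add_const
    (p.1 * q.2 - p.2 * q.1)
  rw [one_mul] at h
  exact h

theorem hasDerivAt_implicit {A B C D E F : ℝ → ℝ} {dA dB dC dD dE dF s : ℝ}
    (hA : HasDerivAt A dA s) (hB : HasDerivAt B dB s) (hC : HasDerivAt C dC s)
    (hD : HasDerivAt D dD s) (hE : HasDerivAt E dE s) (hF : HasDerivAt F dF s)
    (b0 b1 b2 b3 : ℝ) :
    HasDerivAt
      (fun s => b0 * (D s * F s * E s) + b1 * (D s * C s ^ 2) + b2 * (A s ^ 2 * E s) +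
        b3 * B s ^ 3)
      (b0 * ((dD * F s + D s * dF) * E s + D s * F s * dE) +
        b1 * (dD * C s ^ 2 + D s * (2 * C s * dC)) +
        b2 * (2 * A s * dA * E s + A s ^ 2 * dE) + b3 * (3 * B s ^ 2 * dB)) s := by
  have h := (((((hD.mul hF).mul hE).const_mul b0).add ((hD.mul (hC.pow 2)).const_mul b1)).add
    (((hA.pow 2).mul hE).const_mul b2)).add ((hB.pow 3).const_mul b3)
  refine h.congr_deriv ?_
  simp

/-- the lines `S̃₁ = 0`, `S̃₂ = 0` pass through `c0`, `c3` respectively,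
and any common zero of them is a singular point of the implicit curve `q = 0`. -/
theorem singular_lines (c0 c1 c2 c3 : ℝ × ℝ) (w0 w1 w2 w3 : ℝ)
    (hw0 : w0 ≠ 0) (hw1 : w1 ≠ 0) (hw2 : w2 ≠ 0) (hw3 : w3 ≠ 0)
    (u0 u1 u2 u3 : ℝ)
    (hu0 : u0 = w0) (hu1 : u1 = 3 * w1) (hu2 : u2 = 3 * w2) (hu3 : u3 = w3)
    (l0 l1 l2 l3 : ℝ)
    (hl0 : l0 = lam c3 c2 c1) (hl1 : l1 = lam c2 c3 c0)
    (hl2 : l2 = lam c1 c0 c3) (hl3 : l3 = lam c0 c1 c2)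
    (hnc0 : l0 ≠ 0) (hnc1 : l1 ≠ 0) (hnc2 : l2 ≠ 0) (hnc3 : l3 ≠ 0)
    (K0 K1 K2 K3 : ℝ → ℝ → ℝ)
    (hK0 : ∀ x y, K0 x y = lineL c0 c1 x y * lineL c1 c2 x y * lineL c2 c3 x y)
    (hK1 : ∀ x y, K1 x y = lineL c0 c1 x y * (lineL c1 c3 x y) ^ 2)
    (hK2 : ∀ x y, K2 x y = (lineL c0 c2 x y) ^ 2 * lineL c2 c3 x y)
    (hK3 : ∀ x y, K3 x y = (lineL c0 c3 x y) ^ 3)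
    (U L b0 b1 b2 b3 : ℝ)
    (hU : U = u0 * u1 * u2 * u3) (hL : L = l0 * l1 * l2 * l3)
    (hb0 : b0 = -(l1 ^ 2 * l2 ^ 2 * U - u1 ^ 2 * u2 ^ 2 * L))
    (hb1 : b1 = l1 ^ 3 * l3 * U - u1 ^ 3 * u3 * L)
    (hb2 : b2 = l0 * l2 ^ 3 * U - u0 * u2 ^ 3 * L)
    (hb3 : b3 = l0 ^ 2 * l3 ^ 2 * U - u0 ^ 2 * u3 ^ 2 * L)
    (q : ℝ → ℝ → ℝ)
    (hq : ∀ x y, q x y = b0 * K0 x y + b1 * K1 x y + b2 * K2 x y + b3 * K3 x y)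
    (phi1 phi2 phi3 : ℝ)
    (hphi1 : phi1 = u0 * u2 * l1 ^ 2 - u1 ^ 2 * l0 * l2)
    (hphi2 : phi2 = u1 * u3 * l2 ^ 2 - u2 ^ 2 * l1 * l3)
    (hphi3 : phi3 = u1 * u2 * l0 * l3 - u0 * u3 * l1 * l2)
    (hphi1ne : phi1 ≠ 0) (hphi2ne : phi2 ≠ 0)
    (S1 S2 : ℝ → ℝ → ℝ)
    (hS1 : ∀ x y, S1 x y = u2 * phi1 * lineL c0 c2 x y - u1 * phi3 * lineL c0 c3 x y)
    (hS2 : ∀ x y, S2 x y = u1 * phi2 * lineL c1 c3 x y - u2 * phi3 * lineL c0 c3 x y) :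
    S1 c0.1 c0.2 = 0 ∧ S2 c3.1 c3.2 = 0 ∧
      ∀ x y : ℝ, S1 x y = 0 → S2 x y = 0 →
        q x y = 0 ∧ grad q x y = (0 : ℝ × ℝ) := by
  have hu1ne : u1 ≠ 0 := by rw [hu1]; exact mul_ne_zero three_ne_zero hw1
  have hu2ne : u2 ≠ 0 := by rw [hu2]; exact mul_ne_zero three_ne_zero hw2
  refine ⟨?_, ?_, fun x y h1 h2 => ?_⟩
  · rw [hS1]
    simp only [lineL, det3]
    ring
  · rw [hS2]
    simp only [lineL, det3]
    ring
  rw [hS1] at h1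
  rw [hS2] at h2
  have hD : l1 * lineL c0 c1 x y = -l2 * lineL c0 c2 x y - l3 * lineL c0 c3 x y := by
    simp only [hl1, hl2, hl3, lam, lineL, det3]
    ring
  have hE : l2 * lineL c2 c3 x y = -l1 * lineL c1 c3 x y - l0 * lineL c0 c3 x y := by
    simp only [hl0, hl1, hl2, lam, lineL, det3]
    ring
  have hF : l1 * l2 * lineL c1 c2 x y =
      -l0 * l2 * lineL c0 c2 x y - l0 * l3 * lineL c0 c3 x y - l1 * l3 * lineL c1 c3 x y := by
    simp only [hl0, hl1, hl2, hl3, lam, lineL, det3]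
    ring
  have key {dA dB dC dD dE dF : ℝ} :=
    implicit_derivative_eq_zero (dA := dA) (dB := dB) (dC := dC) (dD := dD) (dE := dE)
      (dF := dF) hu1ne hu2ne hnc1 hnc2 hphi1 hphi2 hphi3 hphi1ne hphi2ne h1 h2 hD hE hF
  rw [← hU, ← hL, ← hb0, ← hb1, ← hb2, ← hb3] at key
  have hq' : q = fun x y =>
      b0 * (lineL c0 c1 x y * lineL c1 c2 x y * lineL c2 c3 x y) +
        b1 * (lineL c0 c1 x y * lineL c1 c3 x y ^ 2) +
        b2 * (lineL c0 c2 x y ^ 2 * lineL c2 c3 x y) + b3 * lineL c0 c3 x y ^ 3 := by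
    funext x y
    rw [hq, hK0, hK1, hK2, hK3]
  refine ⟨?_, Prod.ext ?_ ?_⟩
  · rw [hq']
    linear_combination (1 / 3 : ℝ) * key hD hE hF
  · have h := hasDerivAt_implicit (hasDerivAt_lineL_fst c0 c2 x y)
      (hasDerivAt_lineL_fst c0 c3 x y) (hasDerivAt_lineL_fst c1 c3 x y)
      (hasDerivAt_lineL_fst c0 c1 x y) (hasDerivAt_lineL_fst c2 c3 x y)
      (hasDerivAt_lineL_fst c1 c2 x y) b0 b1 b2 b3
    rw [hq']
    refine h.deriv.trans (key ?_ ?_ ?_) <;>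
      simp only [hl0, hl1, hl2, hl3, lam, det3] <;> ring
  · have h := hasDerivAt_implicit (hasDerivAt_lineL_snd c0 c2 x y)
      (hasDerivAt_lineL_snd c0 c3 x y) (hasDerivAt_lineL_snd c1 c3 x y)
      (hasDerivAt_lineL_snd c0 c1 x y) (hasDerivAt_lineL_snd c2 c3 x y)
      (hasDerivAt_lineL_snd c1 c2 x y) b0 b1 b2 b3
    rw [hq']
    refine h.deriv.trans (key ?_ ?_ ?_) <;>
      simp only [hl0, hl1, hl2, hl3, lam, det3] <;> ring
end
end

section
/- Suppose Φ1·Φ2 ≠ 0 and Φ1 + Φ2 − Φ3 ≠ 0. Then there exist real numbers t1 ∈ [0,1] and t2 ∉ [0,1] with r(t1) = 0 and r(t2) = 0 if and only if Φ1·Φ2 < 0. (This characterizes when the rational cubic Bézier curve has an 'unwanted' self-intersection, with exactly one of the two double-point parameters lying in the region of interest [0,1].) -/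
noncomputable section

/-- If a quadratic has two roots, the product of its values at `0` and `1` in terms of them. -/
theorem quadratic_mul_eval_of_sum_of_root {a b c s t : ℝ}
    (hsum : a * (s + t) + b = 0) (hs : a * s ^ 2 + b * s + c = 0) :
    (a + b + c) * c = a ^ 2 * (s * (1 - s)) * (t * (1 - t)) := by
  obtain rfl : b = -(a * (s + t)) := by linarith
  obtain rfl : c = a * s * t := by linear_combination hs
  ring

/-- A quadratic with nonzero values at `0` and `1` has a root inside and a root outside `[0, 1]`
iff these values have opposite signs. -/
theorem exists_root_mem_Icc_and_root_notMem_Icc_iff {a b c : ℝ} (ha : a ≠ 0)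
    (hne : (a + b + c) * c ≠ 0) :
    (∃ s t : ℝ, s ∈ Set.Icc (0 : ℝ) 1 ∧ t ∉ Set.Icc (0 : ℝ) 1 ∧
      a * s ^ 2 + b * s + c = 0 ∧ a * t ^ 2 + b * t + c = 0) ↔ (a + b + c) * c < 0 := by
  constructor
  · rintro ⟨s, t, hs, ht, hrs, hrt⟩
    have hst : s - t ≠ 0 := sub_ne_zero.2 fun h => ht (h ▸ hs)
    have hsum : a * (s + t) + b = 0 :=
      mul_left_cancel₀ hst (by linear_combination hrs - hrt)
    have hprod := quadratic_mul_eval_of_sum_of_root hsum hrs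
    have ht' : t * (1 - t) ≤ 0 := by
      by_contra! h
      exact ht ⟨by nlinarith [sq_nonneg t], by nlinarith [sq_nonneg (1 - t)]⟩
    refine lt_of_le_of_ne ?_ hne
    rw [hprod]
    exact mul_nonpos_of_nonneg_of_nonpos
      (mul_nonneg (sq_nonneg a) (mul_nonneg hs.1 (sub_nonneg.2 hs.2))) ht'
  · intro h
    have hcont : ContinuousOn (fun x : ℝ => a * x ^ 2 + b * x + c) (Set.uIcc 0 1) := by
      fun_prop
    have hmem : (0 : ℝ) ∈ Set.uIcc (a * 0 ^ 2 + b * 0 + c) (a * 1 ^ 2 + b * 1 + c) := by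
      rw [Set.mem_uIcc]
      rcases mul_neg_iff.1 h with ⟨h1, h2⟩ | ⟨h1, h2⟩
      · left; constructor <;> linarith
      · right; constructor <;> linarith
    obtain ⟨s, hs, hrs⟩ := intermediate_value_uIcc hcont hmem
    rw [Set.uIcc_of_le zero_le_one] at hs
    simp only at hrs
    have hsum : a * (s + (-b / a - s)) + b = 0 := by field_simp; ring
    have hprod := quadratic_mul_eval_of_sum_of_root hsum hrs
    refine ⟨s, -b / a - s, hs, fun ht => ?_, hrs, ?_⟩
    · refine h.not_ge ?_
      rw [hprod]
      exact mul_nonneg (mul_nonneg (sq_nonneg a) (mul_nonneg hs.1 (sub_nonneg.2 hs.2)))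
        (mul_nonneg ht.1 (sub_nonneg.2 ht.2))
    · linear_combination hrs + (-b / a - s - s) * hsum

/-- characterization of an unwanted self-intersection: `r` has one root
in `[0,1]` and one outside iff `Φ₁Φ₂ < 0`. -/
theorem unwanted_singularity_iff (c0 c1 c2 c3 : ℝ × ℝ) (w0 w1 w2 w3 : ℝ)
    (u0 u1 u2 u3 : ℝ)
    (hu0 : u0 = w0) (hu1 : u1 = 3 * w1) (hu2 : u2 = 3 * w2) (hu3 : u3 = w3)
    (l0 l1 l2 l3 : ℝ)
    (hl0 : l0 = lam c3 c2 c1) (hl1 : l1 = lam c2 c3 c0)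
    (hl2 : l2 = lam c1 c0 c3) (hl3 : l3 = lam c0 c1 c2)
    (phi1 phi2 phi3 : ℝ)
    (hphi1 : phi1 = u0 * u2 * l1 ^ 2 - u1 ^ 2 * l0 * l2)
    (hphi2 : phi2 = u1 * u3 * l2 ^ 2 - u2 ^ 2 * l1 * l3)
    (hphi3 : phi3 = u1 * u2 * l0 * l3 - u0 * u3 * l1 * l2)
    (P1 P2 P3 : ℝ)
    (hP1 : P1 = phi1 * u2 * u3) (hP2 : P2 = phi2 * u0 * u1) (hP3 : P3 = phi3 * u1 * u2)
    (r : ℝ → ℝ)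
    (hr : ∀ t, r t = P1 * t ^ 2 + P3 * (t * (1 - t)) + P2 * (1 - t) ^ 2)
    (hne : P1 * P2 ≠ 0) (hquad : P1 + P2 - P3 ≠ 0) :
    (∃ t1 t2 : ℝ, t1 ∈ Set.Icc (0 : ℝ) 1 ∧ t2 ∉ Set.Icc (0 : ℝ) 1 ∧ r t1 = 0 ∧ r t2 = 0) ↔
      P1 * P2 < 0 := by
  have hr' : ∀ t, r t = (P1 + P2 - P3) * t ^ 2 + (P3 - 2 * P2) * t + P2 := fun t => by
    rw [hr]; ring
  have hval : P1 + P2 - P3 + (P3 - 2 * P2) + P2 = P1 := by ring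
  have key := exists_root_mem_Icc_and_root_notMem_Icc_iff (b := P3 - 2 * P2) (c := P2) hquad
    (by rwa [hval])
  rw [hval] at key
  simpa only [hr'] using key
end
end
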